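/- Let n ≥ 2 be an even integer. The relatively free algebras of rank n and rank n+1 of the variety generated by A satisfy the same polynomial identities: T(F_n(A)) = T(F_{n+1}(A)). -/

import Mathlib

noncomputable section

/-- `f ∈ K⟨X⟩` (with set of variables `X`) is a polynomial identity of the `K`-algebra `R`:
every substitution of elements of `R` for the variables (i.e. every `K`-algebra homomorphism
from the free algebra to `R`) kills `f`. -/
def IsPI (K : Type) [Field K] {X : Type} (R : Type) [Ring R] [Algebra K R]
    (f : FreeAlgebra K X) : Prop :=
  ∀ φ : FreeAlgebra K X →ₐ[K] R, φ f = 0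

/-- `T(R)`: the set of polynomial identities of `R` inside `K⟨x₁, x₂, …⟩`
(the free unital associative algebra on countably many variables, indexed by `ℕ`). -/
def TId (K : Type) [Field K] (R : Type) [Ring R] [Algebra K R] : Set (FreeAlgebra K ℕ) :=
  {f | IsPI K R f}

/-- A two-sided ideal of `K⟨X⟩` is a T-ideal when it is invariant under all algebra
endomorphisms of `K⟨X⟩`. -/
def IsTIdeal (K : Type) [Field K] (I : TwoSidedIdeal (FreeAlgebra K ℕ)) : Prop :=
  ∀ φ : FreeAlgebra K ℕ →ₐ[K] FreeAlgebra K ℕ, ∀ f ∈ I, φ f ∈ I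

/-- `⟨F⟩^T`: the smallest T-ideal of `K⟨X⟩` containing the set `F`. -/
def TIdealGen (K : Type) [Field K] (F : Set (FreeAlgebra K ℕ)) : Set (FreeAlgebra K ℕ) :=
  {g | ∀ I : TwoSidedIdeal (FreeAlgebra K ℕ), IsTIdeal K I → F ⊆ (I : Set (FreeAlgebra K ℕ)) → g ∈ I}

/-- The commutator `[a, b] = a * b - b * a`. -/
def br {R : Type} [Ring R] (a b : R) : R := a * b - b * a

/-- The left-normed commutator `[a, b, b, …, b]` with `k` occurrences of `b`. -/
def commPow {R : Type} [Ring R] (a b : R) (k : ℕ) : R := (fun y => br y b)^[k] a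

/-- The variable `xᵢ` of `K⟨x₁, x₂, …⟩` (1-based indexing). -/
def xv (K : Type) [Field K] (i : ℕ) : FreeAlgebra K ℕ := FreeAlgebra.ι K i

/-- The product of commutators `[x₁,x₂][x₃,x₄]⋯[x_{2k-1},x_{2k}]`. -/
def chainProd (K : Type) [Field K] (k : ℕ) : FreeAlgebra K ℕ :=
  ((List.range k).map fun i => br (xv K (2 * i + 1)) (xv K (2 * i + 2))).prod

/-- The Grassmann (exterior) algebra of an infinite dimensional `K`-vector space
with basis `e₁, e₂, …`. -/
abbrev Einf (K : Type) [Field K] : Type := ExteriorAlgebra K (ℕ →₀ K)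

/-- The Grassmann (exterior) algebra `E⁽ⁿ⁾` of an `n`-dimensional `K`-vector space. -/
abbrev Efin (K : Type) [Field K] (n : ℕ) : Type := ExteriorAlgebra K (Fin n → K)

/-- The even part `E₀` of the Grassmann algebra of `V`. -/
def evenPart (K V : Type) [Field K] [AddCommGroup V] [Module K V] :
    Submodule K (ExteriorAlgebra K V) :=
  CliffordAlgebra.evenOdd (0 : QuadraticForm K V) 0

/-- The odd part `E₁` of the Grassmann algebra of `V`. -/
def oddPart (K V : Type) [Field K] [AddCommGroup V] [Module K V] :
    Submodule K (ExteriorAlgebra K V) :=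
  CliffordAlgebra.evenOdd (0 : QuadraticForm K V) 1

section matrixAlgebras

variable (K V : Type) [Field K] [AddCommGroup V] [Module K V]

private theorem evenPart_mul_mem {a b : ExteriorAlgebra K V}
    (ha : a ∈ evenPart K V) (hb : b ∈ evenPart K V) : a * b ∈ evenPart K V := by
  have := CliffordAlgebra.evenOdd_mul_le (Q := (0 : QuadraticForm K V)) 0 0
    (Submodule.mul_mem_mul ha hb)
  simpa [evenPart] using this

private theorem evenPart_one_mem : (1 : ExteriorAlgebra K V) ∈ evenPart K V :=
  SetLike.one_mem_graded _

private theorem evenPart_algebraMap_mem (c : K) :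
    algebraMap K (ExteriorAlgebra K V) c ∈ evenPart K V :=
  SetLike.algebraMap_mem_graded _ c

/-- The algebra `A` (over the Grassmann algebra of `V`): the subalgebra of `2 × 2`
matrices over `E = Λ(V)` whose `(1,1)` entry lies in `E₀`, whose `(2,1)` entry is `0`,
and whose `(1,2)` and `(2,2)` entries are arbitrary. -/
def algA : Subalgebra K (Matrix (Fin 2) (Fin 2) (ExteriorAlgebra K V)) where
  carrier := {M | M 0 0 ∈ evenPart K V ∧ M 1 0 = 0}
  mul_mem' := by
    rintro a b ⟨ha0, ha1⟩ ⟨hb0, hb1⟩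
    refine ⟨?_, ?_⟩
    · have h : (a * b) 0 0 = a 0 0 * b 0 0 + a 0 1 * b 1 0 := by
        simp [Matrix.mul_apply, Fin.sum_univ_two]
      rw [h, hb1, mul_zero, add_zero]
      exact evenPart_mul_mem K V ha0 hb0
    · have h : (a * b) 1 0 = a 1 0 * b 0 0 + a 1 1 * b 1 0 := by
        simp [Matrix.mul_apply, Fin.sum_univ_two]
      rw [h, ha1, hb1, zero_mul, mul_zero, add_zero]
  one_mem' := by
    refine ⟨?_, ?_⟩
    · rw [Matrix.one_apply_eq]; exact evenPart_one_mem K V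
    · exact Matrix.one_apply_ne (by decide)
  add_mem' := by
    rintro a b ⟨ha0, ha1⟩ ⟨hb0, hb1⟩
    exact ⟨Submodule.add_mem _ ha0 hb0, by simp [ha1, hb1]⟩
  zero_mem' := ⟨Submodule.zero_mem _, rfl⟩
  algebraMap_mem' := fun c => by
    refine ⟨?_, ?_⟩
    · rw [Matrix.algebraMap_matrix_apply, if_pos rfl]
      exact evenPart_algebraMap_mem K V c
    · rw [Matrix.algebraMap_matrix_apply, if_neg (by decide)]

end matrixAlgebras

section matrixAlgebras2

variable (K V : Type) [Field K] [AddCommGroup V] [Module K V]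

private theorem oddPart_mul_mem_even {a b : ExteriorAlgebra K V}
    (ha : a ∈ oddPart K V) (hb : b ∈ oddPart K V) : a * b ∈ evenPart K V := by
  have := CliffordAlgebra.evenOdd_mul_le (Q := (0 : QuadraticForm K V)) 1 1
    (Submodule.mul_mem_mul ha hb)
  have h2 : ((1 : ZMod 2) + 1) = 0 := by decide
  rw [h2] at this
  exact this

private theorem even_mul_odd_mem {a b : ExteriorAlgebra K V}
    (ha : a ∈ evenPart K V) (hb : b ∈ oddPart K V) : a * b ∈ oddPart K V := by
  have := CliffordAlgebra.evenOdd_mul_le (Q := (0 : QuadraticForm K V)) 0 1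
    (Submodule.mul_mem_mul ha hb)
  rw [zero_add] at this
  exact this

private theorem odd_mul_even_mem {a b : ExteriorAlgebra K V}
    (ha : a ∈ oddPart K V) (hb : b ∈ evenPart K V) : a * b ∈ oddPart K V := by
  have := CliffordAlgebra.evenOdd_mul_le (Q := (0 : QuadraticForm K V)) 1 0
    (Submodule.mul_mem_mul ha hb)
  rw [add_zero] at this
  exact this

/-- The algebra `A′` (over the Grassmann algebra of `V`): the subalgebra of `2 × 2`
matrices over `E = Λ(V)` whose `(2,2)` entry lies in `E₀`, whose `(2,1)` entry is `0`,
and whose `(1,1)` and `(1,2)` entries are arbitrary. -/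
def algA' : Subalgebra K (Matrix (Fin 2) (Fin 2) (ExteriorAlgebra K V)) where
  carrier := {M | M 1 1 ∈ evenPart K V ∧ M 1 0 = 0}
  mul_mem' := by
    rintro a b ⟨ha0, ha1⟩ ⟨hb0, hb1⟩
    refine ⟨?_, ?_⟩
    · have h : (a * b) 1 1 = a 1 0 * b 0 1 + a 1 1 * b 1 1 := by
        simp [Matrix.mul_apply, Fin.sum_univ_two]
      rw [h, ha1, zero_mul, zero_add]
      exact evenPart_mul_mem K V ha0 hb0
    · have h : (a * b) 1 0 = a 1 0 * b 0 0 + a 1 1 * b 1 0 := by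
        simp [Matrix.mul_apply, Fin.sum_univ_two]
      rw [h, ha1, hb1, zero_mul, mul_zero, add_zero]
  one_mem' := by
    refine ⟨?_, ?_⟩
    · rw [Matrix.one_apply_eq]; exact evenPart_one_mem K V
    · exact Matrix.one_apply_ne (by decide)
  add_mem' := by
    rintro a b ⟨ha0, ha1⟩ ⟨hb0, hb1⟩
    exact ⟨Submodule.add_mem _ ha0 hb0, by simp [ha1, hb1]⟩
  zero_mem' := ⟨Submodule.zero_mem _, rfl⟩
  algebraMap_mem' := fun c => by
    refine ⟨?_, ?_⟩
    · rw [Matrix.algebraMap_matrix_apply, if_pos rfl]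
      exact evenPart_algebraMap_mem K V c
    · rw [Matrix.algebraMap_matrix_apply, if_neg (by decide)]

/-- The algebra `M_{1,1}` (over the Grassmann algebra of `V`): the subalgebra of `2 × 2`
matrices over `E = Λ(V)` whose diagonal entries lie in `E₀` and whose off-diagonal entries
lie in `E₁`. -/
def m11 : Subalgebra K (Matrix (Fin 2) (Fin 2) (ExteriorAlgebra K V)) where
  carrier := {M | M 0 0 ∈ evenPart K V ∧ M 1 1 ∈ evenPart K V ∧
    M 0 1 ∈ oddPart K V ∧ M 1 0 ∈ oddPart K V}
  mul_mem' := by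
    rintro a b ⟨ha00, ha11, ha01, ha10⟩ ⟨hb00, hb11, hb01, hb10⟩
    have h00 : (a * b) 0 0 = a 0 0 * b 0 0 + a 0 1 * b 1 0 := by
      simp [Matrix.mul_apply, Fin.sum_univ_two]
    have h11 : (a * b) 1 1 = a 1 0 * b 0 1 + a 1 1 * b 1 1 := by
      simp [Matrix.mul_apply, Fin.sum_univ_two]
    have h01 : (a * b) 0 1 = a 0 0 * b 0 1 + a 0 1 * b 1 1 := by
      simp [Matrix.mul_apply, Fin.sum_univ_two]
    have h10 : (a * b) 1 0 = a 1 0 * b 0 0 + a 1 1 * b 1 0 := by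
      simp [Matrix.mul_apply, Fin.sum_univ_two]
    refine ⟨?_, ?_, ?_, ?_⟩
    · rw [h00]
      exact Submodule.add_mem _ (evenPart_mul_mem K V ha00 hb00)
        (oddPart_mul_mem_even K V ha01 hb10)
    · rw [h11]
      exact Submodule.add_mem _ (oddPart_mul_mem_even K V ha10 hb01)
        (evenPart_mul_mem K V ha11 hb11)
    · rw [h01]
      exact Submodule.add_mem _ (even_mul_odd_mem K V ha00 hb01)
        (odd_mul_even_mem K V ha01 hb11)
    · rw [h10]
      exact Submodule.add_mem _ (odd_mul_even_mem K V ha10 hb00)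
        (even_mul_odd_mem K V ha11 hb10)
  one_mem' := by
    refine ⟨?_, ?_, ?_, ?_⟩
    · rw [Matrix.one_apply_eq]; exact evenPart_one_mem K V
    · rw [Matrix.one_apply_eq]; exact evenPart_one_mem K V
    · rw [Matrix.one_apply_ne (by decide)]; exact Submodule.zero_mem _
    · rw [Matrix.one_apply_ne (by decide)]; exact Submodule.zero_mem _
  add_mem' := by
    rintro a b ⟨ha00, ha11, ha01, ha10⟩ ⟨hb00, hb11, hb01, hb10⟩
    exact ⟨Submodule.add_mem _ ha00 hb00, Submodule.add_mem _ ha11 hb11,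
      Submodule.add_mem _ ha01 hb01, Submodule.add_mem _ ha10 hb10⟩
  zero_mem' := ⟨Submodule.zero_mem _, Submodule.zero_mem _,
    Submodule.zero_mem _, Submodule.zero_mem _⟩
  algebraMap_mem' := fun c => by
    refine ⟨?_, ?_, ?_, ?_⟩
    · rw [Matrix.algebraMap_matrix_apply, if_pos rfl]
      exact evenPart_algebraMap_mem K V c
    · rw [Matrix.algebraMap_matrix_apply, if_pos rfl]
      exact evenPart_algebraMap_mem K V c
    · rw [Matrix.algebraMap_matrix_apply, if_neg (by decide)]
      exact Submodule.zero_mem _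
    · rw [Matrix.algebraMap_matrix_apply, if_neg (by decide)]
      exact Submodule.zero_mem _

end matrixAlgebras2

/-- The relatively free algebra `F_n(R) = K⟨x₁, …, xₙ⟩ / (K⟨x₁, …, xₙ⟩ ∩ T(R))` of rank `n`
of the variety generated by `R`: the quotient of the free algebra on `n` variables by the
ideal of polynomial identities of `R` in those variables. -/
abbrev RelFree (K : Type) [Field K] (R : Type) [Ring R] [Algebra K R] (n : ℕ) : Type :=
  RingQuot (fun f g : FreeAlgebra K (Fin n) => IsPI K R (f - g))

end

open scoped TensorProduct

section ExteriorProducts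

variable {K V J : Type} [Field K] [AddCommGroup V] [Module K V]

/-- The ordered product in the exterior algebra of the vectors `e j`, for `j` in the list `l`. -/
def extProd (K : Type) {V J : Type} [Field K] [AddCommGroup V] [Module K V]
    (e : J → V) (l : List J) : ExteriorAlgebra K V :=
  (l.map fun j => ExteriorAlgebra.ι K (e j)).prod

@[simp]
theorem extProd_nil (e : J → V) : extProd K e [] = 1 := rfl

@[simp]
theorem extProd_cons (e : J → V) (i : J) (l : List J) :
    extProd K e (i :: l) = ExteriorAlgebra.ι K (e i) * extProd K e l := by
  simp [extProd]

theorem extProd_append (e : J → V) (l l' : List J) :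
    extProd K e (l ++ l') = extProd K e l * extProd K e l' := by
  simp [extProd]

theorem ext_ι_mul_swap (v w : V) :
    ExteriorAlgebra.ι K v * ExteriorAlgebra.ι K w =
      -(ExteriorAlgebra.ι K w * ExteriorAlgebra.ι K v) :=
  eq_neg_of_add_eq_zero_left (ExteriorAlgebra.ι_add_mul_swap v w)

theorem ext_contractLeft_ι_mul (d : Module.Dual K V) (v : V) (x : ExteriorAlgebra K V) :
    CliffordAlgebra.contractLeft d (ExteriorAlgebra.ι K v * x) =
      d v • x - ExteriorAlgebra.ι K v * CliffordAlgebra.contractLeft d x :=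
  CliffordAlgebra.contractLeft_ι_mul d v x

theorem contractLeft_extProd_eq_zero (d : Module.Dual K V) (e : J → V) (l : List J)
    (h : ∀ j ∈ l, d (e j) = 0) : CliffordAlgebra.contractLeft d (extProd K e l) = 0 := by
  induction l with
  | nil => exact CliffordAlgebra.contractLeft_one (Q := 0) d
  | cons i l ih =>
    rw [extProd_cons, ext_contractLeft_ι_mul, ih fun j hj => h j (List.mem_cons_of_mem _ hj),
      h i List.mem_cons_self]
    simp

variable [DecidableEq J] {e : J → V} {d : J → Module.Dual K V}

theorem extProd_ne_zero (hd : ∀ i j, d i (e j) = if i = j then 1 else 0) {l : List J}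
    (hl : l.Nodup) : extProd K e l ≠ 0 := by
  induction l with
  | nil => simp
  | cons i l ih =>
    obtain ⟨hi, hl⟩ := List.nodup_cons.1 hl
    intro h
    have key : CliffordAlgebra.contractLeft (d i) (extProd K e l) = 0 :=
      contractLeft_extProd_eq_zero _ _ _ fun j hj => by
        rw [hd, if_neg]; rintro rfl; exact hi hj
    have h2 := ext_contractLeft_ι_mul (d i) (e i) (extProd K e l)
    rw [← extProd_cons, h, map_zero, key, hd] at h2
    simp only [if_true, one_smul, mul_zero, sub_zero] at h2
    exact ih hl h2.symm

theorem exists_eq_extProd_mul (hd : ∀ i j, d i (e j) = if i = j then 1 else 0) {l : List J}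
    (hl : l.Nodup) (y : ExteriorAlgebra K V)
    (hy : ∀ i ∈ l, ExteriorAlgebra.ι K (e i) * y = 0) : ∃ z, y = extProd K e l * z := by
  induction l generalizing y with
  | nil => exact ⟨y, by simp⟩
  | cons i l ih =>
    obtain ⟨hi, hl⟩ := List.nodup_cons.1 hl
    have h1 : y = ExteriorAlgebra.ι K (e i) * CliffordAlgebra.contractLeft (d i) y := by
      have := ext_contractLeft_ι_mul (d i) (e i) y
      rw [hy i List.mem_cons_self, map_zero, hd, if_pos rfl, one_smul] at this
      exact (sub_eq_zero.1 this.symm)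
    obtain ⟨z, hz⟩ := ih hl (CliffordAlgebra.contractLeft (d i) y) fun j hj => by
      have := ext_contractLeft_ι_mul (d i) (e j) y
      rw [hy j (List.mem_cons_of_mem _ hj), map_zero, hd, if_neg, zero_smul, zero_sub] at this
      · exact neg_eq_zero.1 this.symm
      · rintro rfl; exact hi hj
    exact ⟨z, by rw [extProd_cons, mul_assoc, ← hz]; exact h1⟩

theorem extProd_mul_ι_eq_zero (e : J → V) {l : List J} {i : J} (hi : i ∈ l) :
    extProd K e l * ExteriorAlgebra.ι K (e i) = 0 := by
  induction l with
  | nil => simp at hi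
  | cons j l ih =>
    have aux : ∀ l : List J, ∃ c : K, extProd K e l * ExteriorAlgebra.ι K (e i) =
        c • (ExteriorAlgebra.ι K (e i) * extProd K e l) := by
      intro l
      induction l with
      | nil => exact ⟨1, by simp⟩
      | cons j l ih =>
        obtain ⟨c, hc⟩ := ih
        refine ⟨-c, ?_⟩
        rw [extProd_cons, mul_assoc, hc, mul_smul_comm, ← mul_assoc, ← mul_assoc,
          ext_ι_mul_swap (e j), neg_mul, smul_neg, neg_smul]
    by_cases h : i ∈ l
    · rw [extProd_cons, mul_assoc, ih h, mul_zero]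
    · obtain rfl : i = j := by simpa [h] using hi
      obtain ⟨c, hc⟩ := aux l
      rw [extProd_cons, mul_assoc, hc, mul_smul_comm, ← mul_assoc, ExteriorAlgebra.ι_sq_zero,
        zero_mul, smul_zero]

/-- A homomorphism out of a finite dimensional exterior algebra is injective as soon as it does
not vanish on the product of all the basis vectors. -/
theorem ext_injective_of_extProd_ne_zero {m : ℕ} {T : Type} [Ring T] [Algebra K T]
    (Ψ : Efin K m →ₐ[K] T)
    (h : Ψ (extProd K (fun i : Fin m => Pi.single i (1 : K)) (List.finRange m)) ≠ 0) :
    Function.Injective Ψ := by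
  set e : Fin m → Fin m → K := fun i => Pi.single i (1 : K) with he
  have hd : ∀ i j : Fin m, (LinearMap.proj i : Module.Dual K (Fin m → K)) (e j) =
      if i = j then 1 else 0 := by
    intro i j
    simp [he, Pi.single_apply]
  rw [injective_iff_map_eq_zero]
  intro x hx
  by_contra hx0
  have step : ∀ l : List (Fin m), ∃ y, Ψ y = 0 ∧ y ≠ 0 ∧
      ∀ i ∈ l, ExteriorAlgebra.ι K (e i) * y = 0 := by
    intro l
    induction l with
    | nil => exact ⟨x, hx, hx0, by simp⟩
    | cons i l ih =>
      obtain ⟨y, h1, h2, h3⟩ := ih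
      by_cases hi : ExteriorAlgebra.ι K (e i) * y = 0
      · exact ⟨y, h1, h2, by simpa [hi] using h3⟩
      · refine ⟨_, by rw [map_mul, h1, mul_zero], hi, ?_⟩
        intro j hj
        rcases List.mem_cons.1 hj with rfl | hj
        · rw [← mul_assoc, ExteriorAlgebra.ι_sq_zero, zero_mul]
        · rw [← mul_assoc, ext_ι_mul_swap, neg_mul, mul_assoc, h3 j hj, mul_zero, neg_zero]
  obtain ⟨y, h1, h2, h3⟩ := step (List.finRange m)
  obtain ⟨z, rfl⟩ := exists_eq_extProd_mul hd (List.nodup_finRange m) y h3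
  have hz : ∀ z : Efin K m, ∃ c : K,
      extProd K e (List.finRange m) * z = c • extProd K e (List.finRange m) := by
    intro z
    induction z using ExteriorAlgebra.induction with
    | algebraMap r => exact ⟨r, by rw [Algebra.smul_def, Algebra.commutes]⟩
    | ι v =>
      refine ⟨0, ?_⟩
      rw [pi_eq_sum_univ' v, map_sum, Finset.mul_sum, zero_smul]
      refine Finset.sum_eq_zero fun i _ => ?_
      rw [map_smul, mul_smul_comm]
      exact (congrArg _ (extProd_mul_ι_eq_zero e (List.mem_finRange i))).trans (smul_zero _)
    | mul a b ha hb =>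
      obtain ⟨c, hc⟩ := ha
      obtain ⟨c', hc'⟩ := hb
      exact ⟨c * c', by rw [← mul_assoc, hc, smul_mul_assoc, hc', smul_smul]⟩
    | add a b ha hb =>
      obtain ⟨c, hc⟩ := ha
      obtain ⟨c', hc'⟩ := hb
      exact ⟨c + c', by rw [mul_add, hc, hc', add_smul]⟩
  obtain ⟨c, hc⟩ := hz z
  rw [hc] at h1 h2
  rw [map_smul] at h1
  rcases smul_eq_zero.1 h1 with rfl | h1
  · exact h2 (zero_smul _ _)
  · exact h h1

end ExteriorProducts

section Parity

variable {K V : Type} [Field K] [AddCommGroup V] [Module K V]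

theorem ι_mul_ι_commute_ι (u v w : V) :
    Commute (ExteriorAlgebra.ι K u * ExteriorAlgebra.ι K v) (ExteriorAlgebra.ι K w) := by
  rw [commute_iff_eq, mul_assoc, ext_ι_mul_swap v w, mul_neg, ← mul_assoc, ext_ι_mul_swap u w,
    neg_mul, neg_neg, mul_assoc]

theorem mem_center_of_commute_ι {x : ExteriorAlgebra K V}
    (h : ∀ v, Commute x (ExteriorAlgebra.ι K v)) :
    x ∈ Subalgebra.center K (ExteriorAlgebra K V) := by
  rw [Subalgebra.mem_center_iff]
  intro y
  change Commute y x
  induction y using ExteriorAlgebra.induction with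
  | algebraMap r => exact Algebra.commute_algebraMap_left r x
  | ι v => exact (h v).symm
  | mul a b ha hb => exact ha.mul_left hb
  | add a b ha hb => exact ha.add_left hb

theorem ι_mul_ι_mem_center (u v : V) :
    ExteriorAlgebra.ι K u * ExteriorAlgebra.ι K v ∈
      Subalgebra.center K (ExteriorAlgebra K V) :=
  mem_center_of_commute_ι fun w => ι_mul_ι_commute_ι u v w

theorem evenPart_le_center {x : ExteriorAlgebra K V} (hx : x ∈ evenPart K V) :
    x ∈ Subalgebra.center K (ExteriorAlgebra K V) := by
  induction x, hx using CliffordAlgebra.even_induction with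
  | algebraMap r => exact Subalgebra.algebraMap_mem _ r
  | add x y _ _ hx hy => exact add_mem hx hy
  | ι_mul_ι_mul u v x _ hx => exact mul_mem (ι_mul_ι_mem_center u v) hx

theorem oddPart_mul_ι {x : ExteriorAlgebra K V} (hx : x ∈ oddPart K V) (v : V) :
    x * ExteriorAlgebra.ι K v = -(ExteriorAlgebra.ι K v * x) := by
  induction x, hx using CliffordAlgebra.odd_induction with
  | ι u => exact ext_ι_mul_swap u v
  | add x y _ _ hx hy => rw [add_mul, mul_add, hx, hy, neg_add]
  | ι_mul_ι_mul u w x _ hx =>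
    have h := (ι_mul_ι_commute_ι (K := K) u w v).eq
    change ExteriorAlgebra.ι K u * ExteriorAlgebra.ι K w * x * _ =
      -(_ * (ExteriorAlgebra.ι K u * ExteriorAlgebra.ι K w * x))
    rw [mul_assoc, hx, mul_neg, ← mul_assoc, h, mul_assoc]

theorem oddPart_anticomm {x y : ExteriorAlgebra K V} (hx : x ∈ oddPart K V)
    (hy : y ∈ oddPart K V) : x * y = -(y * x) := by
  induction y, hy using CliffordAlgebra.odd_induction with
  | ι u => exact oddPart_mul_ι hx u
  | add y z _ _ hy hz => rw [add_mul, mul_add, hy, hz, neg_add]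
  | ι_mul_ι_mul u w y _ hy =>
    have h := Subalgebra.mem_center_iff.1 (ι_mul_ι_mem_center (K := K) u w) x
    change x * (ExteriorAlgebra.ι K u * ExteriorAlgebra.ι K w * y) =
      -(ExteriorAlgebra.ι K u * ExteriorAlgebra.ι K w * y * x)
    rw [← mul_assoc, h, mul_assoc, hy, mul_neg, mul_assoc (_ * _) y x]

theorem oddPart_mul_self {x : ExteriorAlgebra K V} (hx : x ∈ oddPart K V) : x * x = 0 := by
  induction x, hx using CliffordAlgebra.odd_induction with
  | ι u => exact ExteriorAlgebra.ι_sq_zero u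
  | add x y hx' hy' hx hy =>
    rw [add_mul, mul_add, mul_add, hx, hy, oddPart_anticomm hx' hy']
    simp
  | ι_mul_ι_mul u w x _ hx =>
    have h := Subalgebra.mem_center_iff.1 (ι_mul_ι_mem_center (K := K) u w) x
    change ExteriorAlgebra.ι K u * ExteriorAlgebra.ι K w * x *
      (ExteriorAlgebra.ι K u * ExteriorAlgebra.ι K w * x) = 0
    rw [← h, mul_assoc x, ← mul_assoc _ x, ← h, mul_assoc x, ← mul_assoc x, hx, zero_mul]

end Parity

section Identities

variable {K : Type} [Field K] {X : Type}

theorem IsPI.map_eq_zero_of_range {S T : Type} [Ring S] [Algebra K S] [Ring T] [Algebra K T]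
    {f : FreeAlgebra K X} (hf : IsPI K S f) (Θ : S →ₐ[K] T) (φ : FreeAlgebra K X →ₐ[K] T)
    (h : ∀ i, φ (FreeAlgebra.ι K i) ∈ Θ.range) : φ f = 0 := by
  choose g hg using h
  have hφ : φ = Θ.comp (FreeAlgebra.lift K g) := by
    ext i
    simpa using (hg i).symm
  rw [hφ, AlgHom.comp_apply, hf, map_zero]

/-- Over an infinite field, extending scalars to a polynomial ring preserves identities. -/
theorem IsPI.mvPolynomial_tensor [Infinite K] (σ : Type) {S : Type} [Ring S] [Algebra K S]
    {f : FreeAlgebra K X} (hf : IsPI K S f) : IsPI K (MvPolynomial σ K ⊗[K] S) f := by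
  intro φ
  let b := Module.Basis.ofVectorSpace K S
  let ev : (σ → K) → MvPolynomial σ K ⊗[K] S →ₐ[K] S := fun x =>
    (Algebra.TensorProduct.lid K S).toAlgHom.comp
      (Algebra.TensorProduct.map (MvPolynomial.aeval x) (AlgHom.id K S))
  have key : ∀ x y i, MvPolynomial.eval x
      ((Algebra.TensorProduct.basis (MvPolynomial σ K) b).repr y i) = b.repr (ev x y) i := by
    intro x y i
    induction y using TensorProduct.induction_on with
    | zero => simp
    | tmul p s => simp [ev, MvPolynomial.aeval_eq_eval]
    | add y z hy hz => simp only [map_add, Finsupp.add_apply, hy, hz]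
  apply (Algebra.TensorProduct.basis (MvPolynomial σ K) b).repr.injective
  ext1 i
  apply MvPolynomial.funext
  intro x
  rw [key, ← AlgHom.comp_apply, hf]
  simp

/-- Over an infinite field, extension of scalars preserves identities. -/
theorem IsPI.tensor [Infinite K] (R : Type) [CommRing R] [Algebra K R] {S : Type} [Ring S]
    [Algebra K S] {f : FreeAlgebra K X} (hf : IsPI K S f) : IsPI K (R ⊗[K] S) f := by
  intro φ
  refine (hf.mvPolynomial_tensor R).map_eq_zero_of_range
    (Algebra.TensorProduct.map (MvPolynomial.aeval (id : R → R)) (AlgHom.id K S)) φ fun i => ?_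
  generalize φ (FreeAlgebra.ι K i) = y
  induction y using TensorProduct.induction_on with
  | zero => exact zero_mem _
  | tmul r s => exact ⟨MvPolynomial.X r ⊗ₜ s, by simp⟩
  | add y z hy hz => exact add_mem hy hz

/-- An element is an identity of the relatively free algebra of rank `n` if and only if all its
consequences in `n` variables are identities. -/
theorem mem_TId_relFree_iff {R : Type} [Ring R] [Algebra K R] {n : ℕ} {f : FreeAlgebra K ℕ} :
    f ∈ TId K (RelFree K R n) ↔
      ∀ p : FreeAlgebra K ℕ →ₐ[K] FreeAlgebra K (Fin n), IsPI K R (p f) := by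
  constructor
  · intro hf p χ
    let mk := RingQuot.mkAlgHom K (fun f g : FreeAlgebra K (Fin n) => IsPI K R (f - g))
    have h0 : mk (p f) = 0 := hf (mk.comp p)
    have h1 := RingQuot.liftAlgHom_mkAlgHom_apply K χ
      (s := fun f g : FreeAlgebra K (Fin n) => IsPI K R (f - g))
      (fun {x y} hxy => sub_eq_zero.1 (by rw [← map_sub]; exact hxy χ)) (p f)
    rw [← h1]
    exact (congrArg _ h0).trans (map_zero _)
  · intro h φ
    let mk := RingQuot.mkAlgHom K (fun f g : FreeAlgebra K (Fin n) => IsPI K R (f - g))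
    choose g hg using fun i => RingQuot.mkAlgHom_surjective K
      (fun f g : FreeAlgebra K (Fin n) => IsPI K R (f - g)) (φ (FreeAlgebra.ι K i))
    have hφ : φ = mk.comp (FreeAlgebra.lift K g) := by
      ext i
      simpa using (hg i).symm
    rw [hφ, AlgHom.comp_apply, ← map_zero mk]
    exact RingQuot.mkAlgHom_rel K (by simpa using h (FreeAlgebra.lift K g))

theorem TId_relFree_succ_subset (R : Type) [Ring R] [Algebra K R] (n : ℕ) :
    TId K (RelFree K R (n + 1)) ⊆ TId K (RelFree K R n) := by
  intro f hf
  rw [mem_TId_relFree_iff] at hf ⊢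
  intro p χ
  let χ' : FreeAlgebra K (Fin (n + 1)) →ₐ[K] R :=
    FreeAlgebra.lift K (Fin.snoc (fun i => χ (FreeAlgebra.ι K i)) 0)
  let j : FreeAlgebra K (Fin n) →ₐ[K] FreeAlgebra K (Fin (n + 1)) :=
    FreeAlgebra.lift K fun i => FreeAlgebra.ι K i.castSucc
  have h : χ = χ'.comp j := by
    ext i
    simp [χ', j]
  rw [h]
  exact hf (j.comp p) χ'

end Identities

section Block

variable {K : Type} [Field K]

/-- The subalgebra of upper triangular `2 × 2` matrices over `S` with scalar `(1,1)` entry. -/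
def scalarUpper (K S : Type) [Field K] [Ring S] [Algebra K S] :
    Subalgebra K (Matrix (Fin 2) (Fin 2) S) where
  carrier := {M | M 0 0 ∈ (⊥ : Subalgebra K S) ∧ M 1 0 = 0}
  mul_mem' := by
    rintro a b ⟨ha0, ha1⟩ ⟨hb0, hb1⟩
    simp only [Set.mem_ofPred_eq, Matrix.mul_apply, Fin.sum_univ_two, ha1, hb1, mul_zero, zero_mul,
      add_zero, and_true]
    exact mul_mem ha0 hb0
  add_mem' := by
    rintro a b ⟨ha0, ha1⟩ ⟨hb0, hb1⟩
    exact ⟨add_mem ha0 hb0, by simp [ha1, hb1]⟩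
  algebraMap_mem' c := ⟨⟨c, by simp [Matrix.algebraMap_matrix_apply]⟩,
    by simp [Matrix.algebraMap_matrix_apply]⟩

variable {R S T : Type} [CommRing R] [Algebra K R] [Ring S] [Algebra K S] [Ring T] [Algebra K T]

/-- Commuting homomorphisms `R → T` and `S → T` induce a homomorphism to matrices over `T` from
the extension of scalars to `R` of `scalarUpper K S`. -/
def scalarUpperLift (r : R →ₐ[K] T) (s : S →ₐ[K] T) (h : ∀ a b, Commute (r a) (s b)) :
    R ⊗[K] scalarUpper K S →ₐ[K] Matrix (Fin 2) (Fin 2) T :=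
  Algebra.TensorProduct.lift ((Matrix.scalarAlgHom (Fin 2) K).comp r)
    (s.mapMatrix.comp (scalarUpper K S).val) fun a M => by
      ext i j
      simpa [Matrix.scalarAlgHom] using (h a (M.1 i j)).eq

theorem scalarUpperLift_mem_range {r : R →ₐ[K] T} {s : S →ₐ[K] T}
    {h : ∀ a b, Commute (r a) (s b)} {M : Matrix (Fin 2) (Fin 2) T} (h00 : M 0 0 ∈ r.range)
    (h10 : M 1 0 = 0) (h01 : M 0 1 ∈ (Algebra.TensorProduct.lift r s h).range)
    (h11 : M 1 1 ∈ (Algebra.TensorProduct.lift r s h).range) :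
    M ∈ (scalarUpperLift r s h).range := by
  obtain ⟨a, ha⟩ := h00
  obtain ⟨b, hb⟩ := h01
  obtain ⟨c, hc⟩ := h11
  have hM : M = !![r a, 0; 0, 0] + !![0, Algebra.TensorProduct.lift r s h b; 0, 0] +
      !![0, 0; 0, Algebra.TensorProduct.lift r s h c] := by
    ext i j
    fin_cases i <;> fin_cases j <;> simp_all
  rw [hM]
  refine add_mem (add_mem ?_ ?_) ?_
  · refine ⟨a ⊗ₜ ⟨!![1, 0; 0, 0], one_mem _, rfl⟩, ?_⟩
    ext i j
    fin_cases i <;> fin_cases j <;> simp [scalarUpperLift, Matrix.scalarAlgHom]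
  · clear hb hM
    induction b using TensorProduct.induction_on with
    | zero => convert zero_mem (scalarUpperLift r s h).range; ext i j; fin_cases i <;> fin_cases j <;> simp
    | tmul x y =>
      refine ⟨x ⊗ₜ ⟨!![0, y; 0, 0], zero_mem _, rfl⟩, ?_⟩
      ext i j
      fin_cases i <;> fin_cases j <;> simp [scalarUpperLift, Matrix.scalarAlgHom]
    | add x y hx hy =>
      convert add_mem hx hy using 1
      ext i j
      fin_cases i <;> fin_cases j <;> simp
  · clear hc hM
    induction c using TensorProduct.induction_on with
    | zero => convert zero_mem (scalarUpperLift r s h).range; ext i j; fin_cases i <;> fin_cases j <;> simp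
    | tmul x y =>
      refine ⟨x ⊗ₜ ⟨!![0, 0; 0, y], zero_mem _, rfl⟩, ?_⟩
      ext i j
      fin_cases i <;> fin_cases j <;> simp [scalarUpperLift, Matrix.scalarAlgHom]
    | add x y hx hy =>
      convert add_mem hx hy using 1
      ext i j
      fin_cases i <;> fin_cases j <;> simp

end Block

section Descent

variable {K : Type} [Field K]

/-- The map of exterior algebras sending the `i`-th basis vector to the `g i`-th one. -/
noncomputable def efinMap (K : Type) [Field K] {m : ℕ} (g : Fin m → ℕ) : Efin K m →ₐ[K] Einf K :=
  ExteriorAlgebra.map (Fintype.linearCombination K fun i => Finsupp.single (g i) (1 : K))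

theorem efinMap_ι {m : ℕ} (g : Fin m → ℕ) (i : Fin m) :
    efinMap K g (ExteriorAlgebra.ι K (Pi.single i 1)) =
      ExteriorAlgebra.ι K (Finsupp.single (g i) 1) := by
  simp [efinMap]

theorem efinMap_injective {m : ℕ} {g : Fin m → ℕ} (hg : Function.Injective g) :
    Function.Injective (efinMap K g) := by
  refine ExteriorAlgebra.map_injective
    ⟨LinearMap.pi fun i => Finsupp.lapply (g i), ?_⟩
  ext i j
  simp [Finsupp.single_apply, Pi.single_apply, hg.eq_iff, eq_comm]

theorem efin_le_of_ι_single_mem {m : ℕ} {S : Subalgebra K (Efin K m)}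
    (h : ∀ i, ExteriorAlgebra.ι K (Pi.single i 1) ∈ S) (x : Efin K m) : x ∈ S := by
  induction x using ExteriorAlgebra.induction with
  | algebraMap r => exact S.algebraMap_mem r
  | ι v =>
    rw [pi_eq_sum_univ' v, map_sum]
    refine sum_mem fun i _ => ?_
    rw [map_smul]
    exact S.smul_mem (h i) _
  | mul a b ha hb => exact mul_mem ha hb
  | add a b ha hb => exact add_mem ha hb

/-- The algebra `scalarUpper K E⁽ⁿ⁾` is an `n`-generated subalgebra of `A` when `n ≥ 2`. -/
theorem isPI_scalarUpper_of_mem_TId {n : ℕ} (hn : 2 ≤ n) {f : FreeAlgebra K ℕ}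
    (hf : f ∈ TId K (RelFree K (algA K (ℕ →₀ K)) n)) : IsPI K (scalarUpper K (Efin K n)) f := by
  rw [mem_TId_relFree_iff] at hf
  let m := efinMap K (Fin.val : Fin n → ℕ)
  have hm : Function.Injective m := efinMap_injective Fin.val_injective
  let e : Fin n → Efin K n := fun i => ExteriorAlgebra.ι K (Pi.single i 1)
  let Y : Fin n → Matrix (Fin 2) (Fin 2) (Einf K) := fun i =>
    !![0, if i.1 = 1 then 1 else 0; 0, (if i.1 = 0 then 1 else 0) + m (e i)]
  let χ : FreeAlgebra K (Fin n) →ₐ[K] algA K (ℕ →₀ K) :=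
    FreeAlgebra.lift K fun i => ⟨Y i, zero_mem _, rfl⟩
  let S := ((algA K (ℕ →₀ K)).val.comp χ).range
  have hY : ∀ i, Y i ∈ S := fun i => ⟨FreeAlgebra.ι K i, by simp [χ]⟩
  have h22 : !![0, 0; 0, 1] ∈ S := by
    have he : m (e ⟨0, by omega⟩) * m (e ⟨0, by omega⟩) = 0 := by
      rw [← map_mul, ExteriorAlgebra.ι_sq_zero, map_zero]
    convert sub_mem (add_mem (hY ⟨0, by omega⟩) (hY ⟨0, by omega⟩))
      (mul_mem (hY ⟨0, by omega⟩) (hY ⟨0, by omega⟩)) using 1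
    ext i j
    fin_cases i <;> fin_cases j <;> simp [Y, add_mul, mul_add, he]
  have h12 : !![0, 1; 0, 0] ∈ S := by
    convert sub_mem (mul_mem (hY ⟨1, by omega⟩) h22) (mul_mem h22 (hY ⟨1, by omega⟩)) using 1
    ext i j
    fin_cases i <;> fin_cases j <;> simp [Y]
  have hdiag : ∀ w, !![0, 0; 0, m w] ∈ S := by
    intro w
    let D : Subalgebra K (Efin K n) :=
      { carrier := {w | !![0, 0; 0, m w] ∈ S}
        mul_mem' := fun {a b} ha hb => by
          change !![0, 0; 0, m a] ∈ S at ha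
          change !![0, 0; 0, m b] ∈ S at hb
          change !![0, 0; 0, m (a * b)] ∈ S
          convert mul_mem ha hb using 1
          ext i j
          fin_cases i <;> fin_cases j <;> simp
        add_mem' := fun {a b} ha hb => by
          change !![0, 0; 0, m a] ∈ S at ha
          change !![0, 0; 0, m b] ∈ S at hb
          change !![0, 0; 0, m (a + b)] ∈ S
          convert add_mem ha hb using 1
          ext i j
          fin_cases i <;> fin_cases j <;> simp
        algebraMap_mem' := fun c => by
          change !![0, 0; 0, m (algebraMap K _ c)] ∈ S
          convert S.smul_mem h22 c using 1
          ext i j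
          fin_cases i <;> fin_cases j <;> simp [Algebra.algebraMap_eq_smul_one] }
    refine efin_le_of_ι_single_mem (S := D) (fun i => ?_) w
    change !![0, 0; 0, m (e i)] ∈ S
    by_cases hi : i.1 = 0
    · convert sub_mem (hY i) h22 using 1
      ext j k
      fin_cases j <;> fin_cases k <;> simp [Y, hi]
    · convert mul_mem h22 (hY i) using 1
      ext j k
      fin_cases j <;> fin_cases k <;> simp [Y, hi]
  intro φ
  let Φ : FreeAlgebra K ℕ →ₐ[K] Matrix (Fin 2) (Fin 2) (Einf K) :=
    m.mapMatrix.comp ((scalarUpper K (Efin K n)).val.comp φ)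
  have hΦ : ∀ i, Φ (FreeAlgebra.ι K i) ∈ S := by
    intro i
    obtain ⟨⟨c, hc⟩, h10⟩ := (φ (FreeAlgebra.ι K i)).2
    convert add_mem (add_mem (S.smul_mem (sub_mem S.one_mem h22) c)
      (mul_mem h12 (hdiag ((φ (FreeAlgebra.ι K i)).1 0 1))))
      (hdiag ((φ (FreeAlgebra.ι K i)).1 1 1)) using 1
    ext j k
    fin_cases j <;> fin_cases k <;>
      simp [Φ, ← hc, h10, Algebra.algebraMap_eq_smul_one]
  choose p hp using hΦ
  have hcomp : Φ = ((algA K (ℕ →₀ K)).val.comp χ).comp (FreeAlgebra.lift K p) := by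
    ext1
    funext i
    simpa using (hp i).symm
  have h0 : Φ f = 0 := by
    rw [hcomp, AlgHom.comp_apply, AlgHom.comp_apply, hf]
    simp
  apply Subtype.ext
  refine Matrix.map_injective hm ?_
  simpa [Φ] using h0

end Descent

section Ascent

variable {K : Type} [Field K]

/-- A block triangular evaluation depends linearly on the `(1,2)` entries, so it vanishes as soon
as it vanishes when these are replaced by the standard basis vectors. -/
theorem map_eq_zero_of_unit_entries {m : ℕ} (hm : m ≠ 0)
    (χ : FreeAlgebra K (Fin m) →ₐ[K] algA K (ℕ →₀ K)) (F : FreeAlgebra K (Fin m))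
    (hF : ∀ k, FreeAlgebra.lift K (fun j => !![(χ (FreeAlgebra.ι K j)).1 0 0,
      if j = k then 1 else 0; 0, (χ (FreeAlgebra.ι K j)).1 1 1]) F = 0) : χ F = 0 := by
  let Y : Fin m → FreeAlgebra K (Fin m) →ₐ[K] Matrix (Fin 2) (Fin 2) (Einf K) := fun k =>
    FreeAlgebra.lift K (fun j => !![(χ (FreeAlgebra.ι K j)).1 0 0,
      if j = k then 1 else 0; 0, (χ (FreeAlgebra.ι K j)).1 1 1])
  have key : (∀ k, Y k F 0 0 = (χ F).1 0 0) ∧ (∀ k, Y k F 1 1 = (χ F).1 1 1) ∧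
      (∀ k, Y k F 1 0 = 0) ∧
      (χ F).1 0 1 = ∑ k, (χ (FreeAlgebra.ι K k)).1 0 1 * Y k F 0 1 := by
    clear hF
    induction F using FreeAlgebra.induction with
    | grade0 r => simp [Matrix.algebraMap_matrix_apply]
    | grade1 j => simp [Y]
    | mul a b ha hb =>
      obtain ⟨a00, a11, a10, a01⟩ := ha
      obtain ⟨b00, b11, b10, b01⟩ := hb
      have ca := Subalgebra.mem_center_iff.1 (evenPart_le_center (χ a).2.1)
      refine ⟨fun k => ?_, fun k => ?_, fun k => ?_, ?_⟩
      · simp [Matrix.mul_apply, Fin.sum_univ_two, a00, b00, b10, (χ b).2.2]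
      · simp [Matrix.mul_apply, Fin.sum_univ_two, a11, b11, a10, (χ a).2.2]
      · simp [Matrix.mul_apply, Fin.sum_univ_two, a10, b10]
      · simp only [map_mul, MulMemClass.coe_mul, Matrix.mul_apply, Fin.sum_univ_two, a00, b11, a01,
          b01, Finset.mul_sum, Finset.sum_mul, ← Finset.sum_add_distrib]
        refine Finset.sum_congr rfl fun k _ => ?_
        rw [mul_add, ← mul_assoc, ← ca, mul_assoc, mul_assoc]
    | add a b ha hb =>
      obtain ⟨a00, a11, a10, a01⟩ := ha
      obtain ⟨b00, b11, b10, b01⟩ := hb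
      refine ⟨fun k => ?_, fun k => ?_, fun k => ?_, ?_⟩
      · simp [a00, b00]
      · simp [a11, b11]
      · simp [a10, b10]
      · simp [a01, b01, mul_add, Finset.sum_add_distrib]
  obtain ⟨h00, h11, -, h01⟩ := key
  have hF' : ∀ k, Y k F = 0 := hF
  have k0 : Fin m := ⟨0, Nat.pos_of_ne_zero hm⟩
  apply Subtype.ext
  ext i j
  fin_cases i <;> fin_cases j
  · exact (h00 k0).symm.trans (by rw [hF']; rfl)
  · exact h01.trans (by simp [hF'])
  · exact (χ F).2.2
  · exact (h11 k0).symm.trans (by rw [hF']; rfl)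

theorem exists_even_add_odd (x : Einf K) :
    ∃ a ∈ evenPart K (ℕ →₀ K), ∃ b ∈ oddPart K (ℕ →₀ K), a + b = x := by
  have h := (CliffordAlgebra.evenOdd_isCompl (Q := (0 : QuadraticForm K (ℕ →₀ K)))).sup_eq_top
  exact Submodule.mem_sup.1 (h ▸ Submodule.mem_top (x := x))

theorem mem_TId_of_isPI_scalarUpper [Infinite K] {m : ℕ} (hm : m ≠ 0) {f : FreeAlgebra K ℕ}
    (hf : IsPI K (scalarUpper K (Efin K m)) f) :
    f ∈ TId K (RelFree K (algA K (ℕ →₀ K)) m) := by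
  rw [mem_TId_relFree_iff]
  intro p χ
  refine map_eq_zero_of_unit_entries hm χ (p f) fun k => ?_
  choose u hu θ hθ huθ using fun j => exists_even_add_odd ((χ (FreeAlgebra.ι K j)).1 1 1)
  let s : Efin K m →ₐ[K] Einf K := ExteriorAlgebra.lift K
    ⟨Fintype.linearCombination K θ, fun v => oddPart_mul_self (by
      rw [Fintype.linearCombination_apply]
      exact sum_mem fun i _ => Submodule.smul_mem _ _ (hθ i))⟩
  have hs : ∀ j, s (ExteriorAlgebra.ι K (Pi.single j 1)) = θ j := fun j => by
    simp [s]
  let r := (Subalgebra.center K (Einf K)).val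
  have hrs : ∀ a b, Commute (r a) (s b) := fun a b =>
    (Subalgebra.mem_center_iff.1 a.2 (s b)).symm
  let Θ := scalarUpperLift r s hrs
  let Y : FreeAlgebra K (Fin m) →ₐ[K] Matrix (Fin 2) (Fin 2) (Einf K) :=
    FreeAlgebra.lift K (fun j => !![(χ (FreeAlgebra.ι K j)).1 0 0,
      if j = k then 1 else 0; 0, (χ (FreeAlgebra.ι K j)).1 1 1])
  have hY : ∀ F, Y F ∈ Θ.range := by
    intro F
    induction F using FreeAlgebra.induction with
    | grade0 c => rw [AlgHom.commutes]; exact Subalgebra.algebraMap_mem _ _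
    | grade1 j =>
      refine scalarUpperLift_mem_range ?_ ?_ ?_ ?_
      · simpa [Y, r] using evenPart_le_center (χ (FreeAlgebra.ι K j)).2.1
      · simp [Y]
      · simp only [Y, FreeAlgebra.lift_ι_apply, Matrix.of_apply, Matrix.cons_val]
        split_ifs
        · exact one_mem _
        · exact zero_mem _
      · simp only [Y, FreeAlgebra.lift_ι_apply, Matrix.of_apply, Matrix.cons_val, ← huθ j]
        exact ⟨⟨u j, evenPart_le_center (hu j)⟩ ⊗ₜ 1 +
          1 ⊗ₜ ExteriorAlgebra.ι K (Pi.single j 1), by simp [hs, r]⟩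
    | mul a b ha hb => rw [map_mul]; exact mul_mem ha hb
    | add a b ha hb => rw [map_add]; exact add_mem ha hb
  exact (hf.tensor (Subalgebra.center K (Einf K))).map_eq_zero_of_range Θ (Y.comp p)
    fun i => hY _

end Ascent

section Interchange

theorem add_pow_succ_of_sq_eq_zero {R : Type} [CommRing R] (x : R) {y : R} (hy : y * y = 0)
    (k : ℕ) : (x + y) ^ (k + 1) = x ^ (k + 1) + (k + 1) * x ^ k * y := by
  induction k with
  | zero => simp
  | succ k ih =>
    rw [pow_succ, ih]
    push_cast
    linear_combination ((k : R) + 1) * x ^ k * hy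

theorem sum_pow_of_sq_eq_zero {R : Type} [CommRing R] {q : ℕ → R} (hq : ∀ a, q a * q a = 0)
    (n : ℕ) : (∑ a ∈ Finset.range n, q a) ^ n = n.factorial * ∏ a ∈ Finset.range n, q a ∧
      (∑ a ∈ Finset.range n, q a) ^ (n + 1) = 0 := by
  induction n with
  | zero => simp
  | succ n ih =>
    rw [Finset.sum_range_succ, Finset.prod_range_succ]
    constructor
    · rw [add_pow_succ_of_sq_eq_zero _ (hq n), ih.1, ih.2, Nat.factorial_succ]
      push_cast
      ring
    · rw [add_pow_succ_of_sq_eq_zero _ (hq n), pow_succ, ih.2]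
      simp

variable {K : Type} [Field K]

/-- The `i`-th generator of the infinite dimensional Grassmann algebra. -/
noncomputable def gen (K : Type) [Field K] (i : ℕ) : Einf K :=
  ExteriorAlgebra.ι K (Finsupp.single i 1)

theorem gen_mul_self (i : ℕ) : gen K i * gen K i = 0 := ExteriorAlgebra.ι_sq_zero _

/-- The even element `∑ₐ ζₐ εₐ`, with `ζₐ` and `εₐ` the generators of index `3a + 1` and
`3a + 2`. -/
noncomputable def pairSum (K : Type) [Field K] (n : ℕ) : Subalgebra.center K (Einf K) :=
  ∑ a ∈ Finset.range n, ⟨gen K (3 * a + 1) * gen K (3 * a + 2), ι_mul_ι_mem_center _ _⟩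

theorem coe_pairSum (n : ℕ) : (pairSum K n : Einf K) =
    ∑ a ∈ Finset.range n, gen K (3 * a + 1) * gen K (3 * a + 2) := by
  simp [pairSum]

theorem pairSum_pow (n : ℕ) : (pairSum K n : Einf K) ^ n = (n.factorial : K) •
      extProd K (fun i : ℕ => Finsupp.single i (1 : K))
        ((List.range n).flatMap fun a => [3 * a + 1, 3 * a + 2]) ∧
    (pairSum K n : Einf K) ^ (n + 1) = 0 := by
  let q : ℕ → Subalgebra.center K (Einf K) := fun a =>
    ⟨gen K (3 * a + 1) * gen K (3 * a + 2), ι_mul_ι_mem_center _ _⟩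
  have hq : ∀ a, q a * q a = 0 := fun a => by
    have hc := (ι_mul_ι_commute_ι (K := K) (Finsupp.single (3 * a + 1) (1 : K))
      (Finsupp.single (3 * a + 2) 1) (Finsupp.single (3 * a + 1) 1)).eq
    apply Subtype.ext
    change gen K (3 * a + 1) * gen K (3 * a + 2) * (gen K (3 * a + 1) * gen K (3 * a + 2)) = 0
    change gen K (3 * a + 1) * gen K (3 * a + 2) * gen K (3 * a + 1) = _ at hc
    rw [← mul_assoc, hc]
    change gen K (3 * a + 1) * (gen K (3 * a + 1) * gen K (3 * a + 2)) * _ = 0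
    rw [← mul_assoc (gen K (3 * a + 1)), gen_mul_self, zero_mul, zero_mul]
  obtain ⟨h1, h2⟩ := sum_pow_of_sq_eq_zero hq n
  have hprod : ∀ m : ℕ, ((∏ a ∈ Finset.range m, q a : Subalgebra.center K (Einf K)) : Einf K) =
      extProd K (fun i : ℕ => Finsupp.single i (1 : K))
        ((List.range m).flatMap fun a => [3 * a + 1, 3 * a + 2]) := by
    intro m
    induction m with
    | zero => simp
    | succ m ih =>
      rw [Finset.prod_range_succ, List.range_succ, List.flatMap_append, extProd_append, ← ih]
      simp [q, gen]
  constructor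
  · rw [← hprod, ← SubmonoidClass.coe_pow, pairSum, h1]
    simp [Algebra.smul_def]
  · rw [← SubmonoidClass.coe_pow, pairSum, h2]
    rfl

/-- The linear map underlying `truncMap`. -/
noncomputable def truncLin (K : Type) [Field K] (n : ℕ) : (Fin (n + 1) → K) →ₗ[K] Einf K :=
  (LinearMap.mulRight K (gen K (3 * n + 1) + (pairSum K n : Einf K))).comp
    ((ExteriorAlgebra.ι K).comp
      (Fintype.linearCombination K fun i : Fin (n + 1) => Finsupp.single (3 * i.1) (1 : K)))

theorem ι_mul_shift_mul_ι_mul_shift {Q : Einf K} (hQ : Q ∈ Subalgebra.center K (Einf K))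
    (v w z : ℕ →₀ K) :
    ExteriorAlgebra.ι K v * (ExteriorAlgebra.ι K z + Q) *
      (ExteriorAlgebra.ι K w * (ExteriorAlgebra.ι K z + Q)) =
      ExteriorAlgebra.ι K v * ExteriorAlgebra.ι K w * Q ^ 2 := by
  have hQ' := Subalgebra.mem_center_iff.1 hQ
  have h1 : (ExteriorAlgebra.ι K z + Q) * ExteriorAlgebra.ι K w =
      ExteriorAlgebra.ι K w * (Q - ExteriorAlgebra.ι K z) := by
    rw [add_mul, mul_sub, ext_ι_mul_swap z w, hQ', neg_add_eq_sub]
  have h2 : (Q - ExteriorAlgebra.ι K z) * (ExteriorAlgebra.ι K z + Q) = Q ^ 2 := by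
    rw [sub_mul, mul_add, mul_add, ExteriorAlgebra.ι_sq_zero, hQ' (ExteriorAlgebra.ι K z), sq]
    abel
  rw [mul_assoc, ← mul_assoc _ (ExteriorAlgebra.ι K w), h1, mul_assoc _ _ (_ + _), h2, mul_assoc]

/-- The homomorphism from the Grassmann algebra on `n + 1` generators sending the `i`-th generator
`ξᵢ` to `ξᵢ (ζₙ + ∑ₐ ζₐ εₐ)`, where `a < n` in the sum. -/
noncomputable def truncMap (K : Type) [Field K] (n : ℕ) : Efin K (n + 1) →ₐ[K] Einf K :=
  ExteriorAlgebra.lift K ⟨truncLin K n, fun v => by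
    simp only [truncLin, LinearMap.comp_apply, LinearMap.mulRight_apply, gen]
    rw [ι_mul_shift_mul_ι_mul_shift (pairSum K n).2, ExteriorAlgebra.ι_sq_zero, zero_mul]⟩

theorem truncMap_ι (n : ℕ) (i : Fin (n + 1)) :
    truncMap K n (ExteriorAlgebra.ι K (Pi.single i 1)) =
      gen K (3 * i.1) * (gen K (3 * n + 1) + (pairSum K n : Einf K)) := by
  simp [truncMap, truncLin, gen]

theorem prod_gen_mul_shift (n k : ℕ) (l : List ℕ) (hl : l.length = 2 * k) :
    (l.map fun i => gen K (3 * i) * (gen K (3 * n + 1) + (pairSum K n : Einf K))).prod =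
      extProd K (fun i : ℕ => Finsupp.single i (1 : K)) (l.map (3 * ·)) *
        (pairSum K n : Einf K) ^ (2 * k) := by
  induction k generalizing l with
  | zero =>
    obtain rfl := List.length_eq_zero_iff.1 hl
    simp
  | succ k ih =>
    match l, hl with
    | a :: b :: l, hl =>
      have hQ := Subalgebra.mem_center_iff.1 ((pairSum K n) ^ 2).2
      rw [List.map_cons, List.map_cons, List.prod_cons, List.prod_cons, ← mul_assoc,
        ih l (by simpa [mul_add] using hl)]
      simp only [gen]
      rw [ι_mul_shift_mul_ι_mul_shift (pairSum K n).2, List.map_cons, List.map_cons, extProd_cons,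
        extProd_cons, mul_add, pow_add, mul_assoc _ (_ ^ 2), ← SubmonoidClass.coe_pow, ← hQ]
      simp only [SubmonoidClass.coe_pow, mul_assoc]

theorem truncMap_extProd_ne_zero [CharZero K] {n : ℕ} (hn : Even n) :
    truncMap K n (extProd K (fun i : Fin (n + 1) => Pi.single i (1 : K))
      (List.finRange (n + 1))) ≠ 0 := by
  obtain ⟨k, hk⟩ := hn.two_dvd
  let l : List ℕ := (List.finRange n).map fun i => i.1 + 1
  have h1 : truncMap K n (extProd K (fun i : Fin (n + 1) => Pi.single i (1 : K))
      (List.finRange (n + 1))) =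
      gen K (3 * 0) * (gen K (3 * n + 1) + (pairSum K n : Einf K)) *
        (l.map fun i => gen K (3 * i) * (gen K (3 * n + 1) + (pairSum K n : Einf K))).prod := by
    rw [extProd, map_list_prod, List.finRange_succ]
    simp [truncMap_ι, l, Function.comp_def]
  have hQ := Subalgebra.mem_center_iff.1 (pairSum K n).2
  obtain ⟨hp, hp'⟩ := pairSum_pow (K := K) n
  have h2 : truncMap K n (extProd K (fun i : Fin (n + 1) => Pi.single i (1 : K))
      (List.finRange (n + 1))) = (n.factorial : K) •
      extProd K (fun i : ℕ => Finsupp.single i (1 : K))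
        (3 * 0 :: (3 * n + 1) :: (l.map (3 * ·) ++
          (List.range n).flatMap fun a => [3 * a + 1, 3 * a + 2])) := by
    rw [h1, prod_gen_mul_shift n k l (by simp [l, hk]), ← hk, mul_add, add_mul,
      mul_assoc _ (pairSum K n : Einf K), ← mul_assoc (pairSum K n : Einf K), ← hQ,
      mul_assoc _ (pairSum K n : Einf K), ← pow_succ', hp', mul_zero (M₀ := Einf K),
      mul_zero (M₀ := Einf K),
      add_zero, hp, extProd_cons, extProd_cons, extProd_append]
    simp only [gen, mul_smul_comm, mul_assoc]
  rw [h2]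
  refine smul_ne_zero (by exact_mod_cast n.factorial_ne_zero)
    (extProd_ne_zero (d := fun i => Finsupp.lapply i) ?_ ?_)
  · intro i j
    simp [Finsupp.single_apply, eq_comm]
  · have hl : (l.map (3 * ·)).Nodup := by
      rw [List.map_map]
      exact (List.nodup_finRange n).map fun i j h => Fin.ext (by simp at h; omega)
    have hr : ((List.range n).flatMap fun a => [3 * a + 1, 3 * a + 2]).Nodup := by
      rw [List.nodup_flatMap]
      refine ⟨by simp, ?_⟩
      refine List.nodup_range.imp fun {a b} hab => ?_
      simp [Function.onFun]
      omega
    simp only [List.nodup_cons, List.nodup_append, hl, hr, List.mem_append, List.mem_map,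
      List.mem_flatMap, l]
    simp
    grind

theorem truncMap_injective [CharZero K] {n : ℕ} (hn : Even n) :
    Function.Injective (truncMap K n) :=
  ext_injective_of_extProd_ne_zero _ (truncMap_extProd_ne_zero hn)

theorem isPI_scalarUpper_succ [CharZero K] {n : ℕ} (hn : Even n) {f : FreeAlgebra K ℕ}
    (hf : IsPI K (scalarUpper K (Efin K n)) f) :
    IsPI K (scalarUpper K (Efin K (n + 1))) f := by
  intro φ
  let r := (Subalgebra.center K (Einf K)).val
  let s := efinMap K fun i : Fin n => 3 * i.1 + 2
  have hrs : ∀ a b, Commute (r a) (s b) := fun a b =>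
    (Subalgebra.mem_center_iff.1 a.2 (s b)).symm
  let D := (Algebra.TensorProduct.lift r s hrs).range
  have hr : ∀ v w, ExteriorAlgebra.ι K v * ExteriorAlgebra.ι K w ∈ D := fun v w =>
    ⟨⟨_, ι_mul_ι_mem_center v w⟩ ⊗ₜ 1, by simp [r]⟩
  have hs : ∀ a ∈ Finset.range n, gen K (3 * a + 2) ∈ D := fun a ha =>
    ⟨1 ⊗ₜ ExteriorAlgebra.ι K (Pi.single ⟨a, Finset.mem_range.1 ha⟩ 1), by
      simp [s, efinMap_ι, gen]⟩
  have hD : ∀ x, truncMap K n x ∈ D := by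
    intro x
    refine efin_le_of_ι_single_mem (S := D.comap (truncMap K n)) (fun i => ?_) x
    rw [Subalgebra.mem_comap, truncMap_ι, coe_pairSum, mul_add, Finset.mul_sum]
    refine add_mem (hr _ _) (sum_mem fun a ha => ?_)
    rw [← mul_assoc]
    exact mul_mem (hr _ _) (hs a ha)
  let Φ : FreeAlgebra K ℕ →ₐ[K] Matrix (Fin 2) (Fin 2) (Einf K) :=
    (truncMap K n).mapMatrix.comp ((scalarUpper K (Efin K (n + 1))).val.comp φ)
  have h0 : Φ f = 0 := by
    refine (hf.tensor (Subalgebra.center K (Einf K))).map_eq_zero_of_range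
      (scalarUpperLift r s hrs) Φ fun i => scalarUpperLift_mem_range ?_ ?_ (hD _) (hD _)
    · obtain ⟨c, hc⟩ := (φ (FreeAlgebra.ι K i)).2.1
      exact ⟨algebraMap K _ c, by simp [Φ, ← hc]⟩
    · simp [Φ, (φ (FreeAlgebra.ι K i)).2.2]
  apply Subtype.ext
  refine Matrix.map_injective (truncMap_injective hn) ?_
  simpa [Φ] using h0

end Interchange

/-- For even `n ≥ 2`, the relatively free algebras `F_n(A)` and `F_{n+1}(A)`
satisfy the same polynomial identities. -/
theorem tideal_relfree_algA_succ (K : Type) [Field K] [CharZero K]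
    (n : ℕ) (hn : 2 ≤ n) (hne : Even n) :
    TId K (RelFree K (↥(algA K (ℕ →₀ K))) n) =
      TId K (RelFree K (↥(algA K (ℕ →₀ K))) (n + 1)) := by
  refine Set.Subset.antisymm (fun f hf => ?_) (TId_relFree_succ_subset _ n)
  exact mem_TId_of_isPI_scalarUpper n.succ_ne_zero
    (isPI_scalarUpper_succ hne (isPI_scalarUpper_of_mem_TId hn hf))
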